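/- Suppose (w_μ + w_ȳ)·δ < w_y̲·c. Then the maximizer of F over the six-point set S is as follows: (a) if c_m ≤ w_ȳ·(p − c − δ), then F(d_ȳ, d_y̲) ≥ F(x, q) for all (x, q) ∈ S; (b) if w_ȳ·(p − c − δ) < c_m ≤ (w_μ + w_ȳ)·(p − c − δ), then F(d_μ, d_y̲) ≥ F(x, q) for all (x, q) ∈ S; (c) if (w_μ + w_ȳ)·(p − c − δ) < c_m, then F(d_y̲, d_y̲) ≥ F(x, q) for all (x, q) ∈ S. -/

import Mathlib

/-- Realized demand: `d_y = (1 - p) * y`. -/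
noncomputable def dem (p y : ℝ) : ℝ := (1 - p) * y

/-- Second-stage (quick-response) production quantity. -/
noncomputable def qdel (p x q y : ℝ) : ℝ := min (max (dem p y - q) 0) (x - q)

/-- Profit function. -/
noncomputable def profit (p c cm δ x q y : ℝ) : ℝ :=
  p * min (dem p y) (q + qdel p x q y) - cm * x - c * q - (c + δ) * qdel p x q y

theorem profit_low (p c cm δ x q y : ℝ) (h : (1 - p) * y ≤ q) (hx : q ≤ x) :
    profit p c cm δ x q y = p * ((1 - p) * y) - cm * x - c * q := by
  have e : qdel p x q y = 0 := by
    unfold qdel dem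
    rw [max_eq_right (by linarith), min_eq_left (by linarith)]
  unfold profit
  rw [e]; unfold dem
  rw [min_eq_left (by linarith)]; ring

theorem profit_mid (p c cm δ x q y : ℝ) (h : q ≤ (1 - p) * y) (hx : (1 - p) * y ≤ x) :
    profit p c cm δ x q y =
      p * ((1 - p) * y) - cm * x - c * q - (c + δ) * ((1 - p) * y - q) := by
  have e : qdel p x q y = (1 - p) * y - q := by
    unfold qdel dem
    rw [max_eq_left (by linarith), min_eq_left (by linarith)]
  unfold profit
  rw [e]; unfold dem
  rw [min_eq_left (by linarith)]

theorem profit_high (p c cm δ x q y : ℝ) (h : q ≤ x) (hx : x ≤ (1 - p) * y) :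
    profit p c cm δ x q y = p * x - cm * x - c * q - (c + δ) * (x - q) := by
  have e : qdel p x q y = x - q := by
    unfold qdel dem
    rw [max_eq_left (by linarith), min_eq_right (by linarith)]
  unfold profit
  rw [e]; unfold dem
  rw [min_eq_right (by linarith)]; ring

theorem stmt14
    (p c cm δ : ℝ) (hp0 : 0 < p) (hp1 : p < 1)
    (hc : 0 < c) (hcm : 0 < cm) (hδ : 0 ≤ δ) (hprof : c + δ + cm < p)
    (ylo μ yhi σ : ℝ) (h1 : ylo < μ) (h2 : μ < yhi) (hσ : 0 < σ)
    (hfeas : σ / (2 * (μ - ylo)) + σ / (2 * (yhi - μ)) ≤ 1)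
    (wlo wmu whi : ℝ)
    (hwlo : wlo = σ / (2 * (μ - ylo)))
    (hwhi : whi = σ / (2 * (yhi - μ)))
    (hwmu : wmu = 1 - wlo - whi)
    (dlo dmu dhi : ℝ)
    (hdlo : dlo = (1 - p) * ylo) (hdmu : dmu = (1 - p) * μ) (hdhi : dhi = (1 - p) * yhi)
    (F : ℝ → ℝ → ℝ)
    (hF : F = fun x q => wlo * profit p c cm δ x q ylo + wmu * profit p c cm δ x q μ +
      whi * profit p c cm δ x q yhi)
    (S : Set (ℝ × ℝ))
    (hS : S = {(dlo, dlo), (dmu, dlo), (dmu, dmu), (dhi, dlo), (dhi, dmu), (dhi, dhi)})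
    (hcase : (wmu + whi) * δ < wlo * c) :
    (cm ≤ whi * (p - c - δ) → ∀ pq ∈ S, F dhi dlo ≥ F pq.1 pq.2) ∧
    (whi * (p - c - δ) < cm → cm ≤ (wmu + whi) * (p - c - δ) →
      ∀ pq ∈ S, F dmu dlo ≥ F pq.1 pq.2) ∧
    ((wmu + whi) * (p - c - δ) < cm → ∀ pq ∈ S, F dlo dlo ≥ F pq.1 pq.2) := by
  have hlo : 0 < wlo := by
    rw [hwlo]; exact div_pos hσ (by linarith)
  have hhi : 0 < whi := by
    rw [hwhi]; exact div_pos hσ (by linarith)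
  have hmu : 0 ≤ wmu := by
    rw [hwmu, hwlo, hwhi]; linarith
  have D1 : dlo < dmu := by
    rw [hdlo, hdmu]; exact mul_lt_mul_of_pos_left h1 (by linarith)
  have D2 : dmu < dhi := by
    rw [hdmu, hdhi]; exact mul_lt_mul_of_pos_left h2 (by linarith)
  have E1 : F dmu dlo = F dlo dlo + (dmu - dlo) * ((wmu + whi) * (p - c - δ) - cm) := by
    simp only [hF]
    rw [profit_low p c cm δ dmu dlo ylo (by linarith) (by linarith),
      profit_mid p c cm δ dmu dlo μ (by linarith) (by linarith),
      profit_high p c cm δ dmu dlo yhi (by linarith) (by linarith),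
      profit_low p c cm δ dlo dlo ylo (by linarith) (by linarith),
      profit_high p c cm δ dlo dlo μ (by linarith) (by linarith),
      profit_high p c cm δ dlo dlo yhi (by linarith) (by linarith)]
    simp only [← hdlo, ← hdmu, ← hdhi]
    rw [hwmu]; ring
  have E2 : F dhi dlo = F dmu dlo + (dhi - dmu) * (whi * (p - c - δ) - cm) := by
    simp only [hF]
    rw [profit_low p c cm δ dhi dlo ylo (by linarith) (by linarith),
      profit_mid p c cm δ dhi dlo μ (by linarith) (by linarith),
      profit_mid p c cm δ dhi dlo yhi (by linarith) (by linarith),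
      profit_low p c cm δ dmu dlo ylo (by linarith) (by linarith),
      profit_mid p c cm δ dmu dlo μ (by linarith) (by linarith),
      profit_high p c cm δ dmu dlo yhi (by linarith) (by linarith)]
    simp only [← hdlo, ← hdmu, ← hdhi]
    rw [hwmu]; ring
  have E3 : F dmu dmu = F dmu dlo + (dmu - dlo) * ((wmu + whi) * δ - wlo * c) := by
    simp only [hF]
    rw [profit_low p c cm δ dmu dmu ylo (by linarith) (by linarith),
      profit_low p c cm δ dmu dmu μ (by linarith) (by linarith),
      profit_high p c cm δ dmu dmu yhi (by linarith) (by linarith),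
      profit_low p c cm δ dmu dlo ylo (by linarith) (by linarith),
      profit_mid p c cm δ dmu dlo μ (by linarith) (by linarith),
      profit_high p c cm δ dmu dlo yhi (by linarith) (by linarith)]
    simp only [← hdlo, ← hdmu, ← hdhi]
    rw [hwmu]; ring
  have E4 : F dhi dmu = F dhi dlo + (dmu - dlo) * ((wmu + whi) * δ - wlo * c) := by
    simp only [hF]
    rw [profit_low p c cm δ dhi dmu ylo (by linarith) (by linarith),
      profit_low p c cm δ dhi dmu μ (by linarith) (by linarith),
      profit_mid p c cm δ dhi dmu yhi (by linarith) (by linarith),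
      profit_low p c cm δ dhi dlo ylo (by linarith) (by linarith),
      profit_mid p c cm δ dhi dlo μ (by linarith) (by linarith),
      profit_mid p c cm δ dhi dlo yhi (by linarith) (by linarith)]
    simp only [← hdlo, ← hdmu, ← hdhi]
    rw [hwmu]; ring
  have E5 : F dhi dhi = F dhi dmu + (dhi - dmu) * (whi * δ - (wlo + wmu) * c) := by
    simp only [hF]
    rw [profit_low p c cm δ dhi dhi ylo (by linarith) (by linarith),
      profit_low p c cm δ dhi dhi μ (by linarith) (by linarith),
      profit_low p c cm δ dhi dhi yhi (by linarith) (by linarith),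
      profit_low p c cm δ dhi dmu ylo (by linarith) (by linarith),
      profit_low p c cm δ dhi dmu μ (by linarith) (by linarith),
      profit_mid p c cm δ dhi dmu yhi (by linarith) (by linarith)]
    simp only [← hdlo, ← hdmu, ← hdhi]
    rw [hwmu]; ring
  have N1 : (dmu - dlo) * ((wmu + whi) * δ - wlo * c) ≤ 0 :=
    mul_nonpos_of_nonneg_of_nonpos (by linarith) (by linarith)
  have N2 : (dhi - dmu) * (whi * δ - (wlo + wmu) * c) ≤ 0 :=
    mul_nonpos_of_nonneg_of_nonpos (by linarith)
      (by nlinarith [mul_nonneg hmu hδ, mul_nonneg hmu hc.le])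
  have M : whi * (p - c - δ) ≤ (wmu + whi) * (p - c - δ) :=
    mul_le_mul_of_nonneg_right (by linarith) (by linarith)
  subst hS
  refine ⟨fun h => ?_, fun h h' => ?_, fun h => ?_⟩
  · have A := mul_nonneg (sub_nonneg.2 D1.le) (sub_nonneg.2 (h.trans M))
    have B := mul_nonneg (sub_nonneg.2 D2.le) (sub_nonneg.2 h)
    rintro pq (rfl | rfl | rfl | rfl | rfl | rfl) <;> dsimp only <;> linarith
  · have A := mul_nonneg (sub_nonneg.2 D1.le) (sub_nonneg.2 h')
    have B := mul_nonpos_of_nonneg_of_nonpos (sub_nonneg.2 D2.le) (sub_nonpos.2 h.le)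
    rintro pq (rfl | rfl | rfl | rfl | rfl | rfl) <;> dsimp only <;> linarith
  · have A := mul_nonpos_of_nonneg_of_nonpos (sub_nonneg.2 D1.le) (sub_nonpos.2 h.le)
    have B := mul_nonpos_of_nonneg_of_nonpos (sub_nonneg.2 D2.le)
      (sub_nonpos.2 (M.trans h.le))
    rintro pq (rfl | rfl | rfl | rfl | rfl | rfl) <;> dsimp only <;> linarith
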